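/- For each 2 ≤ n ≤ 2ʲ − 1, the truncated wavelet space W_jⁿ = W_j ∩ V_{j+1}ⁿ has dimension (2n−1)² − n² = 3n² − 4n + 1, where V_{j+1}ⁿ = span{φ^{j+1}_{(i,k)} : 1 ≤ i,k ≤ 2n−1} and W_j is the Dirichlet-orthogonal complement of V_j in V_{j+1}. -/

import Mathlib

noncomputable section
open MeasureTheory

/-- The unit square Ω = (0,1) × (0,1). -/
def Omg : Set (ℝ × ℝ) := Set.Ioo 0 1 ×ˢ Set.Ioo 0 1

/-- Partial derivative in the x-direction. -/
def pdx (f : (ℝ × ℝ) → ℝ) (x : ℝ × ℝ) : ℝ := fderiv ℝ f x (1, 0)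

/-- Partial derivative in the y-direction. -/
def pdy (f : (ℝ × ℝ) → ℝ) (x : ℝ × ℝ) : ℝ := fderiv ℝ f x (0, 1)

/-- The Dirichlet inner product ⟨u,v⟩ₛ = ∫_Ω ∇u·∇v. -/
def dirInner (u v : (ℝ × ℝ) → ℝ) : ℝ :=
  ∫ x in Omg, pdx u x * pdx v x + pdy u x * pdy v x

/-- The piecewise-linear hat function of mesh `h` centered at `p` on the
type-1 (three-direction) triangulation. -/
def hat (h : ℝ) (p x : ℝ × ℝ) : ℝ :=
  max 0 (1 - (max |x.1 - p.1| (max |x.2 - p.2| |(x.1 - p.1) - (x.2 - p.2)|)) / h)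

/-- The hat function φʲ_{(m,n)} at the vertex (m/2ʲ, n/2ʲ) of the type-1
triangulation of Ω of mesh 2^{-j} (vanishing on ∂Ω for interior vertices). -/
def hatL (j m n : ℕ) : (ℝ × ℝ) → ℝ :=
  hat ((2 : ℝ) ^ j)⁻¹ ((m : ℝ) / 2 ^ j, (n : ℝ) / 2 ^ j)

/-- The FEM space V_j: the span of the hat functions at the (2ʲ−1)² interior
vertices of the mesh-2^{-j} type-1 triangulation of Ω. -/
def Vsp (j : ℕ) : Submodule ℝ ((ℝ × ℝ) → ℝ) :=
  Submodule.span ℝ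
    {f | ∃ m n : ℕ, 1 ≤ m ∧ m ≤ 2 ^ j - 1 ∧ 1 ≤ n ∧ n ≤ 2 ^ j - 1 ∧ f = hatL j m n}

/-- The truncated fine space V_{j+1}ⁿ = span{φ^{j+1}_{(i,k)} : 1 ≤ i,k ≤ 2n−1}. -/
def VspN (j n : ℕ) : Submodule ℝ ((ℝ × ℝ) → ℝ) :=
  Submodule.span ℝ
    {f | ∃ i k : ℕ, 1 ≤ i ∧ i ≤ 2 * n - 1 ∧ 1 ≤ k ∧ k ≤ 2 * n - 1 ∧ f = hatL (j + 1) i k}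

/-- The truncated wavelet space W_jⁿ = W_j ∩ V_{j+1}ⁿ. -/
def WsetN (j n : ℕ) : Set ((ℝ × ℝ) → ℝ) :=
  {w | w ∈ VspN j n ∧ ∀ v ∈ Vsp j, dirInner w v = 0}

/-- The space of real-valued Lipschitz functions on the plane. -/
def lipschitzFunctions : Submodule ℝ ((ℝ × ℝ) → ℝ) where
  carrier := {f | ∃ K, LipschitzWith K f}
  add_mem' := by
    rintro f g ⟨K, hf⟩ ⟨L, hg⟩
    exact ⟨K + L, hf.add hg⟩
  zero_mem' := ⟨0, LipschitzWith.const 0⟩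
  smul_mem' := by
    rintro c f ⟨K, hf⟩
    exact ⟨‖c‖₊ * K, (lipschitzWith_smul c).comp hf⟩

theorem integrableOn_fderiv_mul_fderiv {f g : (ℝ × ℝ) → ℝ} (hf : f ∈ lipschitzFunctions)
    (hg : g ∈ lipschitzFunctions) (e : ℝ × ℝ) :
    IntegrableOn (fun x => fderiv ℝ f x e * fderiv ℝ g x e) Omg := by
  obtain ⟨K, hf⟩ := hf
  obtain ⟨L, hg⟩ := hg
  refine Measure.integrableOn_of_bounded (M := (K * ‖e‖) * (L * ‖e‖)) ?_ ?_ ?_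
  · refine (((Bornology.IsBounded.prod (Metric.isBounded_Ioo 0 1)
      (Metric.isBounded_Ioo 0 1)).measure_lt_top (μ := volume))).ne
  · exact ((measurable_fderiv_apply_const ℝ f e).mul
      (measurable_fderiv_apply_const ℝ g e)).aestronglyMeasurable
  · refine Filter.Eventually.of_forall fun x => ?_
    rw [norm_mul]
    gcongr
    · exact (fderiv ℝ f x).le_of_opNorm_le (norm_fderiv_le_of_lipschitz ℝ hf) e
    · exact (fderiv ℝ g x).le_of_opNorm_le (norm_fderiv_le_of_lipschitz ℝ hg) e

theorem integrableOn_dirInner {f g : (ℝ × ℝ) → ℝ} (hf : f ∈ lipschitzFunctions)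
    (hg : g ∈ lipschitzFunctions) :
    IntegrableOn (fun x => pdx f x * pdx g x + pdy f x * pdy g x) Omg :=
  (integrableOn_fderiv_mul_fderiv hf hg (1, 0)).add (integrableOn_fderiv_mul_fderiv hf hg (0, 1))

theorem dirInner_comm (f g : (ℝ × ℝ) → ℝ) : dirInner f g = dirInner g f := by
  simp only [dirInner, mul_comm]

theorem dirInner_add_left {f₁ f₂ g : (ℝ × ℝ) → ℝ} (h₁ : f₁ ∈ lipschitzFunctions)
    (h₂ : f₂ ∈ lipschitzFunctions) (hg : g ∈ lipschitzFunctions) :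
    dirInner (f₁ + f₂) g = dirInner f₁ g + dirInner f₂ g := by
  unfold dirInner
  rw [← integral_add (integrableOn_dirInner h₁ hg) (integrableOn_dirInner h₂ hg)]
  obtain ⟨_, h₁⟩ := h₁
  obtain ⟨_, h₂⟩ := h₂
  refine integral_congr_ae (ae_restrict_of_ae ?_)
  filter_upwards [h₁.ae_differentiableAt, h₂.ae_differentiableAt] with x hx₁ hx₂
  simp only [pdx, pdy, fderiv_add hx₁ hx₂, add_apply]
  ring

theorem dirInner_smul_left (c : ℝ) {f g : (ℝ × ℝ) → ℝ} (hf : f ∈ lipschitzFunctions) :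
    dirInner (c • f) g = c * dirInner f g := by
  unfold dirInner
  rw [← integral_const_mul]
  obtain ⟨_, hf⟩ := hf
  refine integral_congr_ae (ae_restrict_of_ae ?_)
  filter_upwards [hf.ae_differentiableAt] with x hx
  simp only [pdx, pdy, fderiv_const_smul hx, smul_apply, smul_eq_mul]
  ring

/-- The Dirichlet inner product as a bilinear form on Lipschitz functions. -/
def dirForm : lipschitzFunctions →ₗ[ℝ] lipschitzFunctions →ₗ[ℝ] ℝ :=
  LinearMap.mk₂ ℝ (fun f g => dirInner f g)
    (fun f₁ f₂ g => dirInner_add_left f₁.2 f₂.2 g.2)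
    (fun c f _ => dirInner_smul_left c f.2)
    (fun f g₁ g₂ => by
      simp only [dirInner_comm (f : (ℝ × ℝ) → ℝ)]
      exact dirInner_add_left g₁.2 g₂.2 f.2)
    (fun c f g => by
      rw [dirInner_comm, dirInner_comm (f : (ℝ × ℝ) → ℝ)]
      exact dirInner_smul_left c g.2)

theorem hat_mem_lipschitzFunctions (h : ℝ) (p : ℝ × ℝ) : hat h p ∈ lipschitzFunctions := by
  have h₁ : LipschitzWith (1 + 0) fun x : ℝ × ℝ => x.1 - p.1 :=
    LipschitzWith.prod_fst.sub (LipschitzWith.const p.1)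
  have h₂ : LipschitzWith (1 + 0) fun x : ℝ × ℝ => x.2 - p.2 :=
    LipschitzWith.prod_snd.sub (LipschitzWith.const p.2)
  have hN := lipschitzWith_one_norm (E := ℝ)
  have hmax := (hN.comp h₁).max ((hN.comp h₂).max (hN.comp (h₁.sub h₂)))
  have := ((LipschitzWith.const (1 : ℝ)).sub ((lipschitzWith_smul h⁻¹).comp hmax)).const_max 0
  simp only [Function.comp_apply, Real.norm_eq_abs, smul_eq_mul, ← div_eq_inv_mul] at this
  exact ⟨_, this⟩

theorem hat_nonneg (h : ℝ) (p x : ℝ × ℝ) : 0 ≤ hat h p x := le_max_left _ _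

theorem fderiv_hat_of_eq_zero {h : ℝ} {p x : ℝ × ℝ} (hx : hat h p x = 0) :
    fderiv ℝ (hat h p) x = 0 :=
  IsLocalMin.fderiv_eq_zero (Filter.Eventually.of_forall fun y => hx ▸ hat_nonneg h p y)

theorem dirInner_hat_eq_zero {h k : ℝ} {p q : ℝ × ℝ}
    (hpq : ∀ x, hat h p x = 0 ∨ hat k q x = 0) : dirInner (hat h p) (hat k q) = 0 := by
  unfold dirInner
  refine integral_eq_zero_of_ae (Filter.Eventually.of_forall fun x => ?_)
  rcases hpq x with hx | hx <;> simp [pdx, pdy, fderiv_hat_of_eq_zero hx]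

theorem hat_eq_zero_iff {h : ℝ} (hh : 0 < h) {p x : ℝ × ℝ} :
    hat h p x = 0 ↔ h ≤ |x.1 - p.1| ∨ h ≤ |x.2 - p.2| ∨ h ≤ |(x.1 - p.1) - (x.2 - p.2)| := by
  rw [hat, max_eq_left_iff, sub_nonpos, one_le_div hh, le_max_iff, le_max_iff]

theorem dirInner_hat_eq_zero_of_le {h k : ℝ} (hh : 0 < h) (hk : 0 < k) {p q : ℝ × ℝ}
    (hpq : p.1 + h ≤ q.1 - k ∨ p.2 + h ≤ q.2 - k) : dirInner (hat h p) (hat k q) = 0 := by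
  refine dirInner_hat_eq_zero fun x => ?_
  rw [hat_eq_zero_iff hh, hat_eq_zero_iff hk]
  by_contra! hx
  obtain ⟨⟨h₁, h₂, -⟩, h₃, h₄, -⟩ := hx
  rw [abs_lt] at h₁ h₂ h₃ h₄
  rcases hpq with hpq | hpq <;> linarith

theorem fderiv_apply_nonneg {f : (ℝ × ℝ) → ℝ} {x e : ℝ × ℝ} {δ : ℝ} (hδ : 0 < δ)
    (hf : ∀ r ∈ Set.Icc 0 δ, f x ≤ f (x + r • e)) : 0 ≤ fderiv ℝ f x e := by
  by_cases hd : DifferentiableAt ℝ f x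
  · have hmin : IsLocalMinOn f (segment ℝ x (x + δ • e)) x := by
      refine IsMinOn.localize fun y hy => ?_
      rw [segment_eq_image'] at hy
      obtain ⟨t, ht, rfl⟩ := hy
      have := hf (t * δ) ⟨mul_nonneg ht.1 hδ.le, mul_le_of_le_one_left hδ.le ht.2⟩
      simpa [mul_smul] using this
    have := hmin.hasFDerivWithinAt_nonneg hd.hasFDerivAt.hasFDerivWithinAt
      (mem_posTangentConeAt_of_segment_subset subset_rfl)
    rw [map_smul, smul_eq_mul] at this
    exact nonneg_of_mul_nonneg_right this hδ
  · simp [fderiv_zero_of_not_differentiableAt hd]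

theorem pdx_pdy_of_eventuallyEq_fst {f : (ℝ × ℝ) → ℝ} {x : ℝ × ℝ} {a b : ℝ}
    (hf : f =ᶠ[nhds x] fun y => a + b * y.1) : pdx f x = b ∧ pdy f x = 0 := by
  have : HasFDerivAt f (b • ContinuousLinearMap.fst ℝ ℝ ℝ) x :=
    ((hasFDerivAt_fst.const_mul b).const_add a).congr_of_eventuallyEq hf
  simp [pdx, pdy, this.fderiv]

theorem pdx_pdy_of_eventuallyEq_snd {f : (ℝ × ℝ) → ℝ} {x : ℝ × ℝ} {a b : ℝ}
    (hf : f =ᶠ[nhds x] fun y => a + b * y.2) : pdx f x = 0 ∧ pdy f x = b := by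
  have : HasFDerivAt f (b • ContinuousLinearMap.snd ℝ ℝ ℝ) x :=
    ((hasFDerivAt_snd.const_mul b).const_add a).congr_of_eventuallyEq hf
  simp [pdx, pdy, this.fderiv]

theorem ae_sub_ne_sub (p : ℝ × ℝ) : ∀ᵐ x : ℝ × ℝ, x.1 - p.1 ≠ x.2 - p.2 := by
  rw [ae_iff, Measure.volume_eq_prod, Measure.measure_prod_null]
  · refine Filter.Eventually.of_forall fun x => ?_
    refine Set.Subsingleton.measure_zero (fun y hy z hz => ?_) _
    simp only [Set.mem_preimage, Set.mem_ofPred_eq, not_not] at hy hz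
    linarith
  · simp only [not_not]
    exact measurableSet_eq_fun (by fun_prop) (by fun_prop)

theorem hat_two_mul_eq {h : ℝ} {p x : ℝ × ℝ} (hh : 0 < h) (hx : hat h p x ≠ 0) :
    hat (2 * h) (p.1 + h, p.2 + h) x
      = 1 / 2 + (2 * h)⁻¹ * min (x.1 - p.1) (x.2 - p.2) := by
  rw [ne_eq, hat_eq_zero_iff hh] at hx
  push Not at hx
  obtain ⟨h₁, h₂, h₃⟩ := hx
  rw [abs_lt] at h₁ h₂
  have e : max |x.1 - (p.1 + h)| (max |x.2 - (p.2 + h)|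
      |x.1 - (p.1 + h) - (x.2 - (p.2 + h))|) = h - min (x.1 - p.1) (x.2 - p.2) := by
    rw [abs_of_nonpos (by linarith), abs_of_nonpos (by linarith)]
    rcases le_total (x.1 - p.1) (x.2 - p.2) with h' | h'
    · rw [min_eq_left h', abs_of_nonpos (by linarith), max_eq_left (max_le _ _)] <;> linarith
    · rw [min_eq_right h', abs_of_nonneg (by linarith),
        max_eq_right (le_max_of_le_left (by linarith)), max_eq_left (by linarith)]
      linarith
  have hm : -h < min (x.1 - p.1) (x.2 - p.2) := lt_min h₁.1 h₂.1
  simp only [hat, e]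
  have e' : 1 - (h - min (x.1 - p.1) (x.2 - p.2)) / (2 * h)
      = 1 / 2 + (2 * h)⁻¹ * min (x.1 - p.1) (x.2 - p.2) := by field_simp; ring
  rw [e', max_eq_right]
  rw [← e', sub_nonneg, div_le_one (by positivity)]
  linarith

theorem hat_le_of_max_le {h : ℝ} (hh : 0 < h) {p x y : ℝ × ℝ}
    (hxy : max |y.1 - p.1| (max |y.2 - p.2| |(y.1 - p.1) - (y.2 - p.2)|)
      ≤ max |x.1 - p.1| (max |x.2 - p.2| |(x.1 - p.1) - (x.2 - p.2)|)) :
    hat h p x ≤ hat h p y := by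
  unfold hat
  gcongr

theorem pdx_hat_nonneg {h : ℝ} (hh : 0 < h) {p x : ℝ × ℝ} (hx : x.1 - p.1 < x.2 - p.2) :
    0 ≤ pdx (hat h p) x := by
  refine fderiv_apply_nonneg (sub_pos.2 hx) fun r hr => hat_le_of_max_le hh ?_
  obtain ⟨hr₀, hr₁⟩ := hr
  simp only [Prod.fst_add, Prod.snd_add, Prod.smul_fst, Prod.smul_snd, smul_eq_mul, mul_one,
    mul_zero, add_zero]
  grind

theorem pdy_hat_nonneg {h : ℝ} (hh : 0 < h) {p x : ℝ × ℝ} (hx : x.2 - p.2 < x.1 - p.1) :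
    0 ≤ pdy (hat h p) x := by
  refine fderiv_apply_nonneg (sub_pos.2 hx) fun r hr => hat_le_of_max_le hh ?_
  obtain ⟨hr₀, hr₁⟩ := hr
  simp only [Prod.fst_add, Prod.snd_add, Prod.smul_fst, Prod.smul_snd, smul_eq_mul, mul_one,
    mul_zero, add_zero]
  grind

theorem continuous_hat (h : ℝ) (p : ℝ × ℝ) : Continuous (hat h p) :=
  let ⟨_, hK⟩ := hat_mem_lipschitzFunctions h p
  hK.continuous

theorem dirInner_hat_pos {h : ℝ} (hh : 0 < h) {p : ℝ × ℝ} (hp₁ : h ≤ p.1) (hp₂ : h ≤ p.2)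
    (hp₁' : p.1 < 1) (hp₂' : p.2 < 1) :
    0 < dirInner (hat h p) (hat (2 * h) (p.1 + h, p.2 + h)) := by
  have hcont₁ : Continuous fun x : ℝ × ℝ => x.1 - p.1 := by fun_prop
  have hcont₂ : Continuous fun x : ℝ × ℝ => x.2 - p.2 := by fun_prop
  have hupper {x : ℝ × ℝ} (hx : x.1 - p.1 < x.2 - p.2) (h₀ : hat h p x ≠ 0) :
      pdx (hat (2 * h) (p.1 + h, p.2 + h)) x = (2 * h)⁻¹ ∧
        pdy (hat (2 * h) (p.1 + h, p.2 + h)) x = 0 := by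
    refine pdx_pdy_of_eventuallyEq_fst (a := 1 / 2 - (2 * h)⁻¹ * p.1) ?_
    filter_upwards [(continuous_hat h p).continuousAt.eventually_ne h₀,
      (isOpen_lt hcont₁ hcont₂).mem_nhds hx] with y hy hy'
    rw [hat_two_mul_eq hh hy, min_eq_left (le_of_lt hy')]
    ring
  have hlower {x : ℝ × ℝ} (hx : x.2 - p.2 < x.1 - p.1) (h₀ : hat h p x ≠ 0) :
      pdx (hat (2 * h) (p.1 + h, p.2 + h)) x = 0 ∧
        pdy (hat (2 * h) (p.1 + h, p.2 + h)) x = (2 * h)⁻¹ := by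
    refine pdx_pdy_of_eventuallyEq_snd (a := 1 / 2 - (2 * h)⁻¹ * p.2) ?_
    filter_upwards [(continuous_hat h p).continuousAt.eventually_ne h₀,
      (isOpen_lt hcont₂ hcont₁).mem_nhds hx] with y hy hy'
    rw [hat_two_mul_eq hh hy, min_eq_right (le_of_lt hy')]
    ring
  unfold dirInner
  rw [setIntegral_pos_iff_support_of_nonneg_ae]
  · set U : Set (ℝ × ℝ) := {x | -h < x.1 - p.1} ∩ {x | x.1 - p.1 < x.2 - p.2} ∩
      {x | x.2 - p.2 < 0} with hU
    have hUo : IsOpen U := ((isOpen_lt continuous_const hcont₁).inter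
      (isOpen_lt hcont₁ hcont₂)).inter (isOpen_lt hcont₂ continuous_const)
    refine (IsOpen.measure_pos volume (hUo.inter (isOpen_Ioo.prod isOpen_Ioo))
      ⟨(p.1 - 2 * h / 3, p.2 - h / 3), ?_⟩).trans_le
      (measure_mono (Set.inter_subset_inter_left _ fun x hx => ?_))
    · simp only [hU, Set.mem_inter_iff, Set.mem_ofPred_eq, Set.mem_prod, Set.mem_Ioo]
      refine ⟨⟨⟨?_, ?_⟩, ?_⟩, ⟨?_, ?_⟩, ?_, ?_⟩ <;> linarith
    · have key {y : ℝ × ℝ} (hy : y ∈ U) : hat h p y = 1 + h⁻¹ * (y.1 - p.1) ∧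
          0 < hat h p y := by
        obtain ⟨⟨h₁, h₂⟩, h₃⟩ := hy
        simp only [Set.mem_ofPred_eq] at h₁ h₂ h₃
        have e : hat h p y = max 0 (1 + h⁻¹ * (y.1 - p.1)) := by
          unfold hat
          rw [abs_of_neg (h₂.trans h₃), abs_of_neg h₃, abs_of_neg (sub_neg.2 h₂),
            max_eq_left (max_le _ _)]
          · congr 1; ring
          · linarith
          · linarith
        have hpos : 0 < 1 + h⁻¹ * (y.1 - p.1) := by
          have : 1 + h⁻¹ * (y.1 - p.1) = (h + (y.1 - p.1)) / h := by field_simp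
          rw [this]
          exact div_pos (by linarith) hh
        rw [e, max_eq_right hpos.le]
        exact ⟨rfl, hpos⟩
      have hfine := pdx_pdy_of_eventuallyEq_fst (f := hat h p) (x := x)
        (a := 1 - h⁻¹ * p.1) (b := h⁻¹) (by
          filter_upwards [hUo.mem_nhds hx] with y hy
          rw [(key hy).1]
          ring)
      obtain ⟨hc₁, hc₂⟩ := hupper hx.1.2 (key hx).2.ne'
      rw [Function.mem_support, hfine.1, hfine.2, hc₁, hc₂]
      positivity
  · refine ae_restrict_of_ae ?_
    filter_upwards [ae_sub_ne_sub p] with x hx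
    by_cases h₀ : hat h p x = 0
    · simp [pdx, pdy, fderiv_hat_of_eq_zero h₀]
    rcases hx.lt_or_gt with hx | hx
    · obtain ⟨h₁, h₂⟩ := hupper hx h₀
      have := pdx_hat_nonneg hh hx
      simp only [Pi.zero_apply, h₁, h₂, mul_zero, add_zero]
      positivity
    · obtain ⟨h₁, h₂⟩ := hlower hx h₀
      have := pdy_hat_nonneg hh hx
      simp only [Pi.zero_apply, h₁, h₂, mul_zero, zero_add]
      positivity
  · exact integrableOn_dirInner (hat_mem_lipschitzFunctions _ _) (hat_mem_lipschitzFunctions _ _)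

theorem hatL_vertex (j m n m' n' : ℕ) :
    hatL j m n ((m' : ℝ) / 2 ^ j, (n' : ℝ) / 2 ^ j) = if m = m' ∧ n = n' then 1 else 0 := by
  have hpos : (0 : ℝ) < (2 ^ j)⁻¹ := by positivity
  have key {a b : ℕ} (hab : a ≠ b) : ((2 : ℝ) ^ j)⁻¹ ≤ |(b : ℝ) / 2 ^ j - (a : ℝ) / 2 ^ j| := by
    rw [← sub_div, abs_div, abs_of_pos (by positivity : (0 : ℝ) < 2 ^ j), inv_eq_one_div]
    gcongr
    have : (1 : ℤ) ≤ |(b : ℤ) - a| := Int.one_le_abs (by omega)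
    exact_mod_cast this
  split_ifs with h
  · simp [hatL, hat, h.1, h.2]
  · rw [not_and_or] at h
    rw [hatL, hat_eq_zero_iff hpos]
    exact h.elim (fun h => Or.inl (key h)) fun h => Or.inr (Or.inl (key h))

theorem linearIndependent_hatL (j N : ℕ) :
    LinearIndependent ℝ fun i : Fin N × Fin N => hatL j (i.1 + 1) (i.2 + 1) := by
  rw [Fintype.linearIndependent_iff]
  intro c hc i
  have := congrFun hc ((((i.1 : ℕ) + 1 : ℕ) : ℝ) / 2 ^ j, (((i.2 : ℕ) + 1 : ℕ) : ℝ) / 2 ^ j)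
  simp only [Finset.sum_apply, Pi.smul_apply, hatL_vertex, smul_eq_mul, Pi.zero_apply] at this
  rwa [Finset.sum_eq_single i (fun k _ hk => ?_) (by simp), if_pos ⟨rfl, rfl⟩, mul_one] at this
  rw [if_neg, mul_zero]
  rintro ⟨h₁, h₂⟩
  exact hk (Prod.ext (Fin.ext (by omega)) (Fin.ext (by omega)))

theorem VspN_eq_span_range (j n : ℕ) : VspN j n = Submodule.span ℝ
    (Set.range fun i : Fin (2 * n - 1) × Fin (2 * n - 1) =>
      hatL (j + 1) (i.1 + 1) (i.2 + 1)) := by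
  unfold VspN
  congr 1
  ext f
  constructor
  · rintro ⟨i, k, hi, hi', hk, hk', rfl⟩
    refine ⟨(⟨i - 1, by omega⟩, ⟨k - 1, by omega⟩), ?_⟩
    simp only [Nat.sub_add_cancel hi, Nat.sub_add_cancel hk]
  · rintro ⟨i, rfl⟩
    exact ⟨_, _, by omega, by omega, by omega, by omega, rfl⟩

theorem finrank_VspN (j n : ℕ) : Module.finrank ℝ (VspN j n) = (2 * n - 1) ^ 2 := by
  rw [VspN_eq_span_range, finrank_span_eq_card (linearIndependent_hatL _ _)]
  simp [sq]

theorem hatL_mem_lipschitzFunctions (j m n : ℕ) : hatL j m n ∈ lipschitzFunctions :=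
  hat_mem_lipschitzFunctions _ _

theorem VspN_le_lipschitzFunctions (j n : ℕ) : VspN j n ≤ lipschitzFunctions :=
  Submodule.span_le.2 fun _ ⟨_, _, _, _, _, _, hf⟩ => hf ▸ hatL_mem_lipschitzFunctions _ _ _

theorem dirInner_hatL_eq_zero {j i k m n : ℕ} (h : i + 3 ≤ 2 * m ∨ k + 3 ≤ 2 * n) :
    dirInner (hatL (j + 1) i k) (hatL j m n) = 0 := by
  have key {a b : ℕ} (hab : a + 3 ≤ 2 * b) :
      (a : ℝ) / 2 ^ (j + 1) + ((2 : ℝ) ^ (j + 1))⁻¹ ≤ (b : ℝ) / 2 ^ j - ((2 : ℝ) ^ j)⁻¹ := by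
    have hab' : (a : ℝ) + 3 ≤ 2 * b := by exact_mod_cast hab
    have e₁ : (a : ℝ) / 2 ^ (j + 1) + ((2 : ℝ) ^ (j + 1))⁻¹ = (a + 1) / 2 ^ (j + 1) := by
      field_simp
    have e₂ : (b : ℝ) / 2 ^ j - ((2 : ℝ) ^ j)⁻¹ = (2 * b - 2) / 2 ^ (j + 1) := by
      rw [pow_succ]
      field_simp
    rw [e₁, e₂]
    gcongr
    linarith
  exact dirInner_hat_eq_zero_of_le (by positivity) (by positivity) (h.imp key key)

theorem dirInner_hatL_pos {j m n : ℕ} (hm : m + 1 ≤ 2 ^ j) (hn : n + 1 ≤ 2 ^ j) :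
    0 < dirInner (hatL (j + 1) (2 * m + 1) (2 * n + 1)) (hatL j (m + 1) (n + 1)) := by
  have e (a : ℕ) : (((a + 1 : ℕ) : ℝ) / 2 ^ j)
      = ((2 * a + 1 : ℕ) : ℝ) / 2 ^ (j + 1) + ((2 : ℝ) ^ (j + 1))⁻¹ := by
    rw [pow_succ]
    push_cast
    field_simp
    ring
  have e' : ((2 : ℝ) ^ j)⁻¹ = 2 * ((2 : ℝ) ^ (j + 1))⁻¹ := by
    rw [pow_succ]
    field_simp
  have lower (a : ℕ) : ((2 : ℝ) ^ (j + 1))⁻¹ ≤ ((2 * a + 1 : ℕ) : ℝ) / 2 ^ (j + 1) := by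
    rw [inv_eq_one_div]
    gcongr
    exact_mod_cast Nat.le_add_left 1 (2 * a)
  have upper {a : ℕ} (ha : a + 1 ≤ 2 ^ j) : ((2 * a + 1 : ℕ) : ℝ) / 2 ^ (j + 1) < 1 := by
    rw [div_lt_one (by positivity)]
    have : 2 * a + 1 < 2 ^ (j + 1) := by rw [pow_succ]; omega
    exact_mod_cast this
  unfold hatL
  rw [e, e, e']
  exact dirInner_hat_pos (by positivity) (lower m) (lower n) (upper hm) (upper hn)

/-- A square family of vectors that is triangular with respect to a partial order, with nonzero
diagonal entries, is linearly independent. -/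
theorem linearIndependent_of_triangular {κ : Type*} [Fintype κ] [PartialOrder κ] {M : κ → κ → ℝ}
    (hM : ∀ p q, ¬ q ≤ p → M p q = 0) (hdiag : ∀ p, M p p ≠ 0) : LinearIndependent ℝ M := by
  rw [Fintype.linearIndependent_iff]
  intro c hc p
  induction p using WellFoundedGT.induction with
  | ind p ih =>
    have := congrFun hc p
    simp only [Finset.sum_apply, Pi.smul_apply, smul_eq_mul, Pi.zero_apply] at this
    rw [Finset.sum_eq_single p (fun q _ hq => ?_) (by simp)] at this
    · exact (mul_eq_zero.1 this).resolve_right (hdiag p)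
    · by_cases h : p ≤ q
      · rw [ih q (lt_of_le_of_ne h hq.symm), zero_mul]
      · rw [hM q p h, mul_zero]

/-- The Dirichlet inner products of a truncated fine function with the coarse hat functions whose
support meets the truncated domain. -/
def coarseMoments (j n : ℕ) : VspN j n →ₗ[ℝ] (Fin n × Fin n → ℝ) :=
  LinearMap.pi fun q =>
    dirForm.flip ⟨hatL j (q.1 + 1) (q.2 + 1), hatL_mem_lipschitzFunctions _ _ _⟩ ∘ₗ
      Submodule.inclusion (VspN_le_lipschitzFunctions j n)

theorem coarseMoments_apply {j n : ℕ} (w : VspN j n) (q : Fin n × Fin n) :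
    coarseMoments j n w q = dirInner w (hatL j (q.1 + 1) (q.2 + 1)) := rfl

theorem range_coarseMoments {j n : ℕ} (hn : n ≤ 2 ^ j) :
    LinearMap.range (coarseMoments j n) = ⊤ := by
  rcases Nat.eq_zero_or_pos n with rfl | hpos
  · exact Subsingleton.elim _ _
  have : NeZero n := ⟨hpos.ne'⟩
  let ψ (p : Fin n × Fin n) : VspN j n := ⟨hatL (j + 1) (2 * p.1 + 1) (2 * p.2 + 1),
    Submodule.subset_span ⟨_, _, by omega, by omega, by omega, by omega, rfl⟩⟩
  have hψ : LinearIndependent ℝ fun p => coarseMoments j n (ψ p) := by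
    refine linearIndependent_of_triangular (fun p q hpq => ?_) fun p => ?_
    · rw [coarseMoments_apply]
      refine dirInner_hatL_eq_zero ?_
      rw [Prod.le_def, not_and_or, Fin.le_def, Fin.le_def] at hpq
      omega
    · rw [coarseMoments_apply]
      exact (dirInner_hatL_pos (by omega) (by omega)).ne'
  rw [eq_top_iff, ← hψ.span_eq_top_of_card_eq_finrank (by simp), Submodule.span_le]
  rintro _ ⟨p, rfl⟩
  exact LinearMap.mem_range_self _ _

theorem WsetN_eq_map_ker {j n : ℕ} (hn : n ≤ 2 ^ j - 1) :
    WsetN j n = (LinearMap.ker (coarseMoments j n)).map (VspN j n).subtype := by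
  ext w
  simp only [WsetN, Set.mem_ofPred_eq, SetLike.mem_coe, Submodule.mem_map, LinearMap.mem_ker,
    Submodule.subtype_apply, Subtype.exists, exists_and_right, exists_eq_right]
  refine ⟨fun ⟨hw, h⟩ => ⟨hw, funext fun q => h _ (Submodule.subset_span
    ⟨_, _, by omega, by omega, by omega, by omega, rfl⟩)⟩, fun ⟨hw, h⟩ => ⟨hw, fun v hv => ?_⟩⟩
  have hwL := VspN_le_lipschitzFunctions j n hw
  suffices hv' : v ∈ (LinearMap.ker (dirForm ⟨w, hwL⟩)).map lipschitzFunctions.subtype by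
    obtain ⟨u, hu, rfl⟩ := hv'
    exact hu
  refine Submodule.span_le.2 ?_ hv
  rintro _ ⟨m, k, hm, -, hk, -, rfl⟩
  refine ⟨⟨_, hatL_mem_lipschitzFunctions j m k⟩, ?_, rfl⟩
  change dirInner w (hatL j m k) = 0
  by_cases hmk : m ≤ n ∧ k ≤ n
  · have := congrFun h (⟨m - 1, by omega⟩, ⟨k - 1, by omega⟩)
    simpa only [coarseMoments_apply, Pi.zero_apply, Nat.sub_add_cancel hm, Nat.sub_add_cancel hk] using this
  · suffices hw' : w ∈ (LinearMap.ker (dirForm.flip ⟨_, hatL_mem_lipschitzFunctions j m k⟩)).map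
        lipschitzFunctions.subtype by
      obtain ⟨u, hu, rfl⟩ := hw'
      exact hu
    refine Submodule.span_le.2 ?_ hw
    rintro _ ⟨i, l, _, _, _, _, rfl⟩
    refine ⟨⟨_, hatL_mem_lipschitzFunctions _ i l⟩, ?_, rfl⟩
    exact dirInner_hatL_eq_zero (by omega)

/-- For 2 ≤ n ≤ 2ʲ−1 the truncated wavelet space W_jⁿ has dimension
(2n−1)² − n² = 3n² − 4n + 1. -/
theorem stmt16 (j n : ℕ) (hn2 : 2 ≤ n) (hn : n ≤ 2 ^ j - 1) :
    Module.finrank ℝ (Submodule.span ℝ (WsetN j n)) = 3 * n ^ 2 - 4 * n + 1 := by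
  have : FiniteDimensional ℝ (VspN j n) :=
    Module.finite_of_finrank_pos (by rw [finrank_VspN]; exact pow_pos (by omega) 2)
  have hrank := LinearMap.finrank_range_add_finrank_ker (coarseMoments j n)
  rw [range_coarseMoments (by omega), finrank_top, finrank_VspN, Module.finrank_fintype_fun_eq_card,
    Fintype.card_prod, Fintype.card_fin] at hrank
  rw [WsetN_eq_map_ker hn, Submodule.span_eq, Submodule.finrank_map_subtype_eq]
  obtain ⟨a, rfl⟩ := Nat.exists_eq_add_of_le hn2
  have h₁ : 2 * (2 + a) - 1 = 2 * a + 3 := by omega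
  have h₂ : 3 * (2 + a) ^ 2 - 4 * (2 + a) = 3 * a ^ 2 + 8 * a + 4 := by
    rw [Nat.sub_eq_iff_eq_add (by nlinarith)]
    ring
  rw [h₁] at hrank
  rw [h₂]
  linarith
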